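/- Let Φ = {φ_j}_{j=1}^N be a strongly separated self-similar system on ℝ^m with attractor F and scaling vector r, and set D := D_r and x_1 := sup{x > 0 : N_B(F,x) = 1}. Then the box-counting zeta function ζ_B(s) := s·∫_{x_1}^∞ N_B(F,x) x^{−s−1} dx converges absolutely for every s ∈ ℂ with Re(s) > D, and there exists a meromorphic function on ℂ agreeing with ζ_B on the half-plane Re(s) > D whose set of poles is contained in S_r = {s ∈ ℂ : ∑_{j=1}^N r_j^s = 1}. -/

import Mathlib

open Filter Topology Metric MeasureTheory

/-- The box-counting function `N_B(A,x)`: the maximal number of pairwise disjoint closed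
balls of radius `x⁻¹` whose centers lie in `A`. -/
noncomputable def boxCount {m : ℕ} (A : Set (EuclideanSpace ℝ (Fin m))) (x : ℝ) : ℕ :=
  sSup {n : ℕ | ∃ c : Fin n → EuclideanSpace ℝ (Fin m), (∀ i, c i ∈ A) ∧
    Pairwise fun i j => Disjoint (closedBall (c i) x⁻¹) (closedBall (c j) x⁻¹)}

/-- `φ` is a contracting similarity with scaling ratio `ρ`. -/
def IsSimilarity {X : Type*} [MetricSpace X] (φ : X → X) (ρ : ℝ) : Prop :=
  ∀ x y, dist (φ x) (φ y) = ρ * dist x y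

/-- The set of complex solutions of the Moran equation `∑ r_j^s = 1`. -/
def MoranSet {N : ℕ} (r : Fin N → ℝ) : Set ℂ :=
  {s : ℂ | ∑ j, ((r j : ℂ)) ^ s = 1}

section Mellin

theorem MonotoneOn.locallyIntegrableOn_Ioi_ofReal {g : ℝ → ℝ}
    (hg : MonotoneOn g (Set.Ioi 0)) :
    LocallyIntegrableOn (fun x => (g x : ℂ)) (Set.Ioi 0) := by
  rw [locallyIntegrableOn_iff isOpen_Ioi.isLocallyClosed]
  intro k hk hkc
  exact (MonotoneOn.integrableOn_isCompact hkc (hg.mono hk)).ofReal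

theorem MonotoneOn.comp_mul_left_Ioi {g : ℝ → ℝ} (hg : MonotoneOn g (Set.Ioi 0)) {a : ℝ}
    (ha : 0 < a) : MonotoneOn (fun x => g (a * x)) (Set.Ioi 0) := fun _ hx _ hy hxy =>
  hg (mul_pos ha hx) (mul_pos ha hy) (mul_le_mul_of_nonneg_left hxy ha.le)

theorem MellinConvergent.finset_sum {ι : Type*} (t : Finset ι) {f : ι → ℝ → ℂ} {s : ℂ}
    (hf : ∀ i ∈ t, MellinConvergent (f i) s) :
    HasMellin (fun x => ∑ i ∈ t, f i x) s (∑ i ∈ t, mellin (f i) s) := by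
  constructor
  · simp only [MellinConvergent, Finset.smul_sum]
    exact integrable_finsetSum _ hf
  · simp only [mellin, Finset.smul_sum]
    exact integral_finsetSum _ hf

/-- Nonnegativity of the similarity dimension. -/
theorem moran_dimension_nonneg {N : ℕ} {r : Fin N → ℝ} (hN : 0 < N)
    (hr : ∀ j, r j ∈ Set.Ioo (0 : ℝ) 1) {D : ℝ} (hD : ∑ j, r j ^ D = 1) : 0 ≤ D := by
  by_contra! h
  have h1 := Real.one_lt_rpow_of_pos_of_lt_one_of_neg (hr ⟨0, hN⟩).1 (hr ⟨0, hN⟩).2 h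
  have h2 := Finset.single_le_sum (f := fun j => r j ^ D)
    (fun j _ => Real.rpow_nonneg (hr j).1.le D) (Finset.mem_univ ⟨0, hN⟩)
  linarith

theorem sum_cpow_ne_one_of_dimension_lt {N : ℕ} {r : Fin N → ℝ} (hN : 0 < N)
    (hr : ∀ j, r j ∈ Set.Ioo (0 : ℝ) 1) {D : ℝ} (hD : ∑ j, r j ^ D = 1) {s : ℂ}
    (hs : D < s.re) : ∑ j, (r j : ℂ) ^ s ≠ 1 := by
  intro h
  have h1 : ‖∑ j, (r j : ℂ) ^ s‖ < 1 := by
    calc ‖∑ j, (r j : ℂ) ^ s‖ ≤ ∑ j, ‖(r j : ℂ) ^ s‖ := norm_sum_le _ _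
      _ = ∑ j, r j ^ s.re :=
        Finset.sum_congr rfl fun j _ => Complex.norm_cpow_eq_rpow_re_of_pos (hr j).1 s
      _ < ∑ j, r j ^ D := Finset.sum_lt_sum_of_nonempty ⟨⟨0, hN⟩, Finset.mem_univ _⟩ fun j _ =>
        Real.rpow_lt_rpow_of_exponent_gt (hr j).1 (hr j).2 hs
      _ = 1 := hD
  rw [h] at h1
  simp at h1

/-- Power growth for a monotone function that eventually satisfies a renewal equation. -/
theorem exists_le_rpow_of_renewal {N : ℕ} {r : Fin N → ℝ} (hN : 0 < N)
    (hr : ∀ j, r j ∈ Set.Ioo (0 : ℝ) 1) {D : ℝ} (hD : ∑ j, r j ^ D = 1)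
    {g : ℝ → ℝ} (hg : MonotoneOn g (Set.Ioi 0)) {x₁ : ℝ} (hx₁ : 0 < x₁)
    (hg0 : ∀ x ≤ x₁, g x = 0)
    (hren : ∀ᶠ x in atTop, g x = ∑ j, g (r j * x)) :
    ∃ C, ∀ x, 0 < x → g x ≤ C * x ^ D := by
  have hD0 := moran_dimension_nonneg hN hr hD
  obtain ⟨X, hX⟩ := eventually_atTop.1 hren
  have : Nonempty (Fin N) := ⟨⟨0, hN⟩⟩
  obtain ⟨k, hk⟩ := Finite.exists_max r
  set Y := max X x₁
  have hY0 : 0 < Y := lt_of_lt_of_le hx₁ (le_max_right _ _)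
  have hgY : 0 ≤ g Y := by
    rw [← hg0 x₁ le_rfl]
    exact hg hx₁ hY0 (le_max_right _ _)
  have hp : 0 < x₁ ^ D := Real.rpow_pos_of_pos hx₁ D
  refine ⟨g Y / x₁ ^ D, ?_⟩
  have key : ∀ n : ℕ, ∀ x, 0 < x → x * r k ^ n ≤ Y → g x ≤ g Y / x₁ ^ D * x ^ D := by
    have base : ∀ x, 0 < x → x ≤ Y → g x ≤ g Y / x₁ ^ D * x ^ D := by
      intro x hx hxY
      rcases le_total x x₁ with h | h
      · rw [hg0 x h]
        positivity
      · have h1 : x₁ ^ D ≤ x ^ D := Real.rpow_le_rpow hx₁.le h hD0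
        calc g x ≤ g Y := hg hx hY0 hxY
          _ = g Y / x₁ ^ D * x₁ ^ D := by field_simp
          _ ≤ _ := by gcongr
    intro n
    induction n with
    | zero => intro x hx h; exact base x hx (by simpa using h)
    | succ n ih =>
      intro x hx h
      rcases le_total x Y with hxY | hxY
      · exact base x hx hxY
      · rw [hX x ((le_max_left _ _).trans hxY)]
        calc ∑ j, g (r j * x) ≤ ∑ j, g Y / x₁ ^ D * (r j * x) ^ D := by
              refine Finset.sum_le_sum fun j _ => ih _ (mul_pos (hr j).1 hx) ?_
              refine le_trans ?_ h
              have h2 : r j * x * r k ^ n ≤ r k * x * r k ^ n := by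
                have := (hr k).1
                have := hk j
                gcongr
              calc _ ≤ _ := h2
                _ = _ := by ring
          _ = ∑ j, r j ^ D * (g Y / x₁ ^ D * x ^ D) := by
              refine Finset.sum_congr rfl fun j _ => ?_
              rw [Real.mul_rpow (hr j).1.le hx.le]
              ring
          _ = _ := by rw [← Finset.sum_mul, hD, one_mul]
  intro x hx
  have ht : Tendsto (fun n : ℕ => x * r k ^ n) atTop (𝓝 (x * 0)) :=
    (tendsto_pow_atTop_nhds_zero_of_lt_one (hr k).1.le (hr k).2).const_mul x
  rw [mul_zero] at ht
  obtain ⟨n, hn⟩ := (ht.eventually_lt_const hY0).exists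
  exact key n x hx hn.le

theorem mellinConvergent_of_renewal {N : ℕ} {r : Fin N → ℝ} (hN : 0 < N)
    (hr : ∀ j, r j ∈ Set.Ioo (0 : ℝ) 1) {D : ℝ} (hD : ∑ j, r j ^ D = 1)
    {g : ℝ → ℝ} (hg : MonotoneOn g (Set.Ioi 0)) {x₁ : ℝ} (hx₁ : 0 < x₁)
    (hg0 : ∀ x ≤ x₁, g x = 0)
    (hren : ∀ᶠ x in atTop, g x = ∑ j, g (r j * x)) {s : ℂ} (hs : D < s.re) :
    MellinConvergent (fun x => (g x : ℂ)) (-s) := by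
  obtain ⟨C, hC⟩ := exists_le_rpow_of_renewal hN hr hD hg hx₁ hg0 hren
  refine mellinConvergent_of_isBigO_rpow (a := -D) (b := -s.re - 1)
    hg.locallyIntegrableOn_Ioi_ofReal ?_ (by simpa using hs) ?_ (by simp)
  · refine Asymptotics.IsBigO.of_bound C ?_
    filter_upwards [eventually_gt_atTop x₁] with x hx
    have hx0 := hx₁.trans hx
    have hgx : 0 ≤ g x := by
      rw [← hg0 x₁ le_rfl]
      exact hg hx₁ hx0 hx.le
    rw [neg_neg, Complex.norm_real, Real.norm_of_nonneg hgx,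
      Real.norm_of_nonneg (Real.rpow_nonneg hx0.le D)]
    exact hC x hx0
  · refine Asymptotics.IsBigO.of_bound 0 ?_
    filter_upwards [nhdsWithin_le_nhds (Iio_mem_nhds hx₁)] with x hx
    simp [hg0 x (le_of_lt hx)]

/-- The Mellin transform of a solution of a renewal equation, multiplied by the
characteristic Dirichlet polynomial, extends to an entire function. -/
theorem exists_entire_mellin_of_renewal {N : ℕ} {r : Fin N → ℝ} (hN : 0 < N)
    (hr : ∀ j, r j ∈ Set.Ioo (0 : ℝ) 1) {D : ℝ} (hD : ∑ j, r j ^ D = 1)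
    {g : ℝ → ℝ} (hg : MonotoneOn g (Set.Ioi 0)) {x₁ : ℝ} (hx₁ : 0 < x₁)
    (hg0 : ∀ x ≤ x₁, g x = 0)
    (hren : ∀ᶠ x in atTop, g x = ∑ j, g (r j * x)) :
    ∃ E : ℂ → ℂ, Differentiable ℂ E ∧ ∀ s : ℂ, D < s.re →
      (1 - ∑ j, (r j : ℂ) ^ s) * mellin (fun x => (g x : ℂ)) (-s) = E s := by
  set h : ℝ → ℂ := fun x => (g x : ℂ) - ∑ j, (g (r j * x) : ℂ) with hh
  have hloc : LocallyIntegrableOn h (Set.Ioi 0) := by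
    rw [locallyIntegrableOn_iff isOpen_Ioi.isLocallyClosed]
    intro k hk hkc
    refine Integrable.sub
      (hg.locallyIntegrableOn_Ioi_ofReal.integrableOn_compact_subset hk hkc) ?_
    exact integrable_finsetSum _ fun j _ =>
      (hg.comp_mul_left_Ioi (hr j).1).locallyIntegrableOn_Ioi_ofReal.integrableOn_compact_subset
        hk hkc
  have htop : ∀ᶠ x in atTop, h x = 0 := by
    filter_upwards [hren] with x hx
    simp only [hh]
    rw [hx]
    push_cast
    ring
  have hzero : ∀ᶠ x in 𝓝[>] 0, h x = 0 := by
    filter_upwards [nhdsWithin_le_nhds (Iio_mem_nhds hx₁), self_mem_nhdsWithin] with x hx hx0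
    have h1 : ∀ j, g (r j * x) = 0 := fun j =>
      hg0 _ (le_trans (mul_le_of_le_one_left (le_of_lt hx0) (hr j).2.le) (le_of_lt hx))
    simp [hh, h1, hg0 x (le_of_lt hx)]
  refine ⟨fun s => mellin h (-s), fun s => ?_, fun s hs => ?_⟩
  · have : DifferentiableAt ℂ (mellin h) (-s) := by
      refine mellin_differentiableAt_of_isBigO_rpow (a := (-s).re + 1) (b := (-s).re - 1)
        hloc ?_ (by simp) ?_ (by simp)
      · refine Asymptotics.IsBigO.of_bound 0 ?_
        filter_upwards [htop] with x hx
        simp [hx]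
      · refine Asymptotics.IsBigO.of_bound 0 ?_
        filter_upwards [hzero] with x hx
        simp [hx]
    exact this.comp s differentiableAt_id.neg
  · have hc := mellinConvergent_of_renewal hN hr hD hg hx₁ hg0 hren hs
    have hsum := MellinConvergent.finset_sum Finset.univ
      (f := fun j x => (g (r j * x) : ℂ)) (s := -s) fun j _ =>
        (MellinConvergent.comp_mul_left (f := fun x => (g x : ℂ)) (hr j).1).2 hc
    have hsub := (hasMellin_sub hc hsum.1).2
    rw [hsum.2] at hsub
    simp only [hh]
    rw [hsub, sub_mul, one_mul, Finset.sum_mul]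
    congr 1
    refine Finset.sum_congr rfl fun j _ => ?_
    have := mellin_comp_mul_left (fun x => (g x : ℂ)) (-s) (hr j).1
    rw [this, neg_neg, smul_eq_mul]

end Mellin

section BoxCount

variable {m : ℕ} {A : Set (EuclideanSpace ℝ (Fin m))}

theorem disjoint_closedBall_inv_iff {x : ℝ} (hx : 0 < x) (p q : EuclideanSpace ℝ (Fin m)) :
    Disjoint (closedBall p x⁻¹) (closedBall q x⁻¹) ↔ 2 < x * dist p q := by
  rw [disjoint_closedBall_closedBall_iff (by positivity) (by positivity), ← two_mul,
    ← div_eq_mul_inv, div_lt_iff₀' hx]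

theorem bddAbove_packing (hA : IsCompact A) {x : ℝ} (hx : 0 < x) :
    BddAbove {n : ℕ | ∃ c : Fin n → EuclideanSpace ℝ (Fin m), (∀ i, c i ∈ A) ∧
      Pairwise fun i j => Disjoint (closedBall (c i) x⁻¹) (closedBall (c j) x⁻¹)} := by
  obtain ⟨t, htf, ht⟩ := Metric.totallyBounded_iff.1 hA.totallyBounded x⁻¹ (inv_pos.2 hx)
  refine ⟨htf.toFinset.card, ?_⟩
  rintro n ⟨c, hc, hd⟩
  have h1 : ∀ i, ∃ p ∈ t, c i ∈ ball p x⁻¹ := fun i => by simpa using ht (hc i)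
  choose p hpt hp using h1
  have hinj : Function.Injective p := by
    intro i j hij
    by_contra hne
    refine Set.not_disjoint_iff.2
      ⟨p i, mem_closedBall.2 (mem_ball'.1 (hp i)).le, ?_⟩ (hd hne)
    rw [hij]
    exact mem_closedBall.2 (mem_ball'.1 (hp j)).le
  have := Finset.card_le_card_of_injOn (s := Finset.univ) (t := htf.toFinset) p
    (fun i _ => by simpa using hpt i) hinj.injOn
  simpa using this

theorem card_le_boxCount (hA : IsCompact A) {x : ℝ} (hx : 0 < x) {ι : Type*} [Fintype ι]
    (c : ι → EuclideanSpace ℝ (Fin m)) (hc : ∀ i, c i ∈ A)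
    (hd : Pairwise fun i j => 2 < x * dist (c i) (c j)) :
    Fintype.card ι ≤ boxCount A x := by
  refine le_csSup (bddAbove_packing hA hx)
    ⟨c ∘ (Fintype.equivFin ι).symm, fun i => hc _, fun i j hij =>
      (disjoint_closedBall_inv_iff hx _ _).2 (hd ((Fintype.equivFin ι).symm.injective.ne hij))⟩

theorem exists_packing_boxCount (hA : IsCompact A) {x : ℝ} (hx : 0 < x) :
    ∃ c : Fin (boxCount A x) → EuclideanSpace ℝ (Fin m), (∀ i, c i ∈ A) ∧
      Pairwise fun i j => 2 < x * dist (c i) (c j) := by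
  have hne : {n : ℕ | ∃ c : Fin n → EuclideanSpace ℝ (Fin m), (∀ i, c i ∈ A) ∧
      Pairwise fun i j => Disjoint (closedBall (c i) x⁻¹) (closedBall (c j) x⁻¹)}.Nonempty :=
    ⟨0, Fin.elim0, fun i => i.elim0, fun i => i.elim0⟩
  obtain ⟨c, hc, hd⟩ := Nat.sSup_mem hne (bddAbove_packing hA hx)
  exact ⟨c, hc, fun i j hij => (disjoint_closedBall_inv_iff hx _ _).1 (hd hij)⟩

theorem boxCount_mono (hA : IsCompact A) {x y : ℝ} (hx : 0 < x) (hxy : x ≤ y) :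
    boxCount A x ≤ boxCount A y := by
  obtain ⟨c, hc, hd⟩ := exists_packing_boxCount hA hx
  have := card_le_boxCount hA (hx.trans_le hxy) c hc fun i j hij =>
    (hd hij).trans_le (mul_le_mul_of_nonneg_right hxy dist_nonneg)
  simpa using this

theorem sSup_boxCount_eq_one_pos (hA : IsCompact A) (hA2 : A.Nontrivial) :
    0 < sSup {x : ℝ | 0 < x ∧ boxCount A x = 1} := by
  obtain ⟨p, hp, q, hq, hpq⟩ := hA2
  have hdist : 0 < dist p q := dist_pos.2 hpq
  obtain ⟨d, hd⟩ := Metric.isBounded_iff.1 hA.isBounded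
  have hd0 : 0 ≤ d := dist_nonneg.trans (hd hp hq)
  have hmem : (d + 1)⁻¹ ∈ {x : ℝ | 0 < x ∧ boxCount A x = 1} := by
    have hpos : 0 < (d + 1)⁻¹ := by positivity
    refine ⟨hpos, le_antisymm ?_ ?_⟩
    · obtain ⟨c, hc, hcd⟩ := exists_packing_boxCount hA hpos
      by_contra! h
      have h1 : 2 < (d + 1)⁻¹ * dist (c ⟨0, by omega⟩) (c ⟨1, h⟩) := hcd (by simp)
      have h2 := hd (hc ⟨0, by omega⟩) (hc ⟨1, h⟩)
      rw [inv_mul_eq_div, lt_div_iff₀ (by positivity)] at h1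
      linarith
    · have := card_le_boxCount hA hpos (fun _ : Unit => p) (fun _ => hp)
        fun i j hij => (hij rfl).elim
      simpa using this
  refine lt_of_lt_of_le hmem.1 (le_csSup ⟨3 / dist p q, ?_⟩ hmem)
  rintro x ⟨hx, hx1⟩
  by_contra! h
  rw [div_lt_iff₀ hdist] at h
  have := card_le_boxCount hA hx (fun b : Bool => if b then p else q)
    (by rintro (_ | _) <;> simpa) (by
      rintro (_ | _) (_ | _) hij
      · exact (hij rfl).elim
      · simp only [Bool.false_eq_true, if_true, if_false, dist_comm q p]
        linarith
      · simp only [Bool.false_eq_true, if_true, if_false]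
        linarith
      · exact (hij rfl).elim)
  simp [hx1] at this

end BoxCount

/-- Renewal equation for the box-counting function of a strongly separated attractor. -/
theorem eventually_boxCount_eq_sum {m N : ℕ}
    {φ : Fin N → EuclideanSpace ℝ (Fin m) → EuclideanSpace ℝ (Fin m)}
    {r : Fin N → ℝ} (hr : ∀ j, r j ∈ Set.Ioo (0 : ℝ) 1)
    (hsim : ∀ j, IsSimilarity (φ j) (r j))
    {F : Set (EuclideanSpace ℝ (Fin m))}
    (hFc : IsCompact F) (hFinv : F = ⋃ j, φ j '' F)
    (hsep : Pairwise fun i j => Disjoint (φ i '' F) (φ j '' F)) :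
    ∀ᶠ x in atTop, boxCount F x = ∑ j, boxCount F (r j * x) := by
  have hcont : ∀ j, Continuous (φ j) := fun j =>
    (LipschitzWith.of_dist_le_mul (K := ⟨r j, (hr j).1.le⟩) fun x y => (hsim j x y).le).continuous
  have hcpt : ∀ j, IsCompact (φ j '' F) := fun j => hFc.image (hcont j)
  have hev : ∀ᶠ x : ℝ in atTop, ∀ i j, i ≠ j → ∀ a ∈ φ i '' F, ∀ b ∈ φ j '' F,
      2 < x * dist a b := by
    simp only [eventually_all]
    intro i j hij
    obtain ⟨δ, hδ, hd⟩ :=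
      Metric.exists_pos_forall_lt_edist (hcpt i) (hcpt j).isClosed (hsep hij)
    filter_upwards [eventually_gt_atTop (2 / (δ : ℝ)), eventually_gt_atTop 0]
      with x hx hx0 a ha b hb
    have h1 := hd a ha b hb
    rw [edist_nndist, ENNReal.coe_lt_coe] at h1
    have h2 : (δ : ℝ) < dist a b := h1
    rw [div_lt_iff₀ (by exact_mod_cast hδ)] at hx
    exact hx.trans (mul_lt_mul_of_pos_left h2 hx0)
  have hmaps : ∀ j, ∀ a ∈ F, φ j a ∈ F := fun j a ha => by
    rw [hFinv]
    exact Set.mem_iUnion.2 ⟨j, a, ha, rfl⟩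
  filter_upwards [hev, eventually_gt_atTop 0] with x hx hx0
  refine le_antisymm ?_ ?_
  · obtain ⟨c, hc, hd⟩ := exists_packing_boxCount hFc hx0
    have h1 : ∀ i, ∃ j, ∃ a ∈ F, φ j a = c i := fun i => by
      have := hc i
      rw [hFinv] at this
      simpa using this
    choose J d hdF hdc using h1
    have hcard := Fintype.card_congr (Equiv.sigmaFiberEquiv J)
    rw [Fintype.card_sigma, Fintype.card_fin] at hcard
    rw [← hcard]
    refine Finset.sum_le_sum fun j _ => ?_
    refine card_le_boxCount hFc (mul_pos (hr j).1 hx0) (fun i : {i // J i = j} => d i)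
      (fun i => hdF i) ?_
    rintro ⟨i, hi⟩ ⟨k, hk⟩ hik
    have h2 : 2 < x * dist (c i) (c k) := hd (by simpa using hik)
    rw [← hdc i, ← hdc k, hi, hk, hsim j] at h2
    simp only
    linarith
  · choose c hc hd using fun j => exists_packing_boxCount hFc (mul_pos (hr j).1 hx0)
    have := card_le_boxCount hFc hx0
      (fun p : Σ j, Fin (boxCount F (r j * x)) => φ p.1 (c p.1 p.2))
      (fun p => hmaps _ _ (hc _ _)) ?_
    · simpa using this
    · rintro ⟨i, a⟩ ⟨j, b⟩ hne
      by_cases hij : i = j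
      · subst hij
        have h2 : 2 < r i * x * dist (c i a) (c i b) := hd i (by simpa using hne)
        simp only [hsim i (c i a) (c i b)]
        linarith
      · exact hx i j hij _ ⟨_, hc i a, rfl⟩ _ ⟨_, hc j b, rfl⟩

theorem differentiable_sum_cpow {N : ℕ} {r : Fin N → ℝ}
    (hr : ∀ j, r j ∈ Set.Ioo (0 : ℝ) 1) :
    Differentiable ℂ fun s : ℂ => ∑ j, (r j : ℂ) ^ s := by
  refine Differentiable.fun_sum fun j _ s => ?_
  exact differentiableAt_id.const_cpow (Or.inl (by exact_mod_cast (hr j).1.ne'))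

/-- For a strongly separated self-similar system with attractor `F`, similarity dimension
`D`, and `x₁ = sup {x > 0 : N_B(F,x) = 1}`, the box-counting zeta function
`ζ_B(s) = s ∫_{x₁}^∞ N_B(F,x) x^{-s-1} dx` converges absolutely for `Re s > D`, and it
extends to a meromorphic function on `ℂ` whose poles all lie in
`S_r = {s : ∑ r_j^s = 1}`. -/
theorem stmt15 {m N : ℕ} (hN : 2 ≤ N)
    (φ : Fin N → EuclideanSpace ℝ (Fin m) → EuclideanSpace ℝ (Fin m))
    (r : Fin N → ℝ) (hr : ∀ j, r j ∈ Set.Ioo (0 : ℝ) 1)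
    (hsim : ∀ j, IsSimilarity (φ j) (r j))
    (F : Set (EuclideanSpace ℝ (Fin m)))
    (hFne : F.Nonempty) (hFc : IsCompact F) (hFinv : F = ⋃ j, φ j '' F)
    (hsep : Pairwise fun i j => Disjoint (φ i '' F) (φ j '' F))
    (D : ℝ) (hD : ∑ j, r j ^ D = 1)
    (x₁ : ℝ) (hx₁ : x₁ = sSup {x : ℝ | 0 < x ∧ boxCount F x = 1}) :
    (∀ s : ℂ, D < s.re →
      MeasureTheory.IntegrableOn
        (fun x : ℝ => (boxCount F x : ℂ) * (x : ℂ) ^ (-s - 1)) (Set.Ioi x₁)) ∧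
    ∃ Z : ℂ → ℂ, MeromorphicOn Z Set.univ ∧
      (∀ s : ℂ, D < s.re →
        Z s = s * (∫ x in Set.Ioi x₁, (boxCount F x : ℂ) * (x : ℂ) ^ (-s - 1))) ∧
      (∀ x : ℂ, x ∉ MoranSet r → AnalyticAt ℂ Z x) := by
  have hN0 : 0 < N := by omega
  have hFnt : F.Nontrivial := by
    obtain ⟨a, ha⟩ := hFne
    have hmem : ∀ j, φ j a ∈ F := fun j => by
      rw [hFinv]
      exact Set.mem_iUnion.2 ⟨j, a, ha, rfl⟩
    refine ⟨_, hmem ⟨0, hN0⟩, _, hmem ⟨1, hN⟩, ?_⟩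
    exact Set.disjoint_iff_forall_ne.1 (hsep (by simp)) ⟨a, ha, rfl⟩ ⟨a, ha, rfl⟩
  have hx0 : 0 < x₁ := hx₁ ▸ sSup_boxCount_eq_one_pos hFc hFnt
  set g : ℝ → ℝ := (Set.Ioi x₁).indicator fun x => (boxCount F x : ℝ)
  have hg0 : ∀ x ≤ x₁, g x = 0 := fun x hx => Set.indicator_of_notMem (by simpa using hx) _
  have hg1 : ∀ x, x₁ < x → g x = boxCount F x := fun x hx => Set.indicator_of_mem hx _
  have hmono : MonotoneOn g (Set.Ioi 0) := by
    intro x hx y _ hxy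
    rcases le_or_gt x x₁ with h | h
    · rw [hg0 x h]
      exact Set.indicator_nonneg (fun _ _ => Nat.cast_nonneg _) _
    · rw [hg1 x h, hg1 y (h.trans_le hxy)]
      exact_mod_cast boxCount_mono hFc hx hxy
  have hren : ∀ᶠ x in atTop, g x = ∑ j, g (r j * x) := by
    have h1 : ∀ᶠ x in atTop, ∀ j, x₁ < r j * x := by
      rw [eventually_all]
      exact fun j => (tendsto_id.const_mul_atTop (hr j).1).eventually_gt_atTop x₁
    filter_upwards [h1, eventually_gt_atTop x₁,
      eventually_boxCount_eq_sum hr hsim hFc hFinv hsep] with x hx hxx hb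
    rw [hg1 x hxx, hb, Nat.cast_sum]
    exact Finset.sum_congr rfl fun j _ => (hg1 _ (hx j)).symm
  have hfun : ∀ s : ℂ, (fun x : ℝ => (x : ℂ) ^ (-s - 1) • (g x : ℂ)) =
      (Set.Ioi x₁).indicator fun x : ℝ => (boxCount F x : ℂ) * (x : ℂ) ^ (-s - 1) := by
    intro s
    ext x
    rcases le_or_gt x x₁ with h | h
    · rw [hg0 x h, Set.indicator_of_notMem (by simpa using h)]
      simp
    · rw [hg1 x h, Set.indicator_of_mem (Set.mem_Ioi.2 h)]
      simp [mul_comm]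
  have hsub : Set.Ioi x₁ ⊆ Set.Ioi 0 := Set.Ioi_subset_Ioi hx0.le
  have hmel : ∀ s : ℂ, mellin (fun x => (g x : ℂ)) (-s) =
      ∫ x in Set.Ioi x₁, (boxCount F x : ℂ) * (x : ℂ) ^ (-s - 1) := by
    intro s
    rw [mellin, hfun, setIntegral_indicator measurableSet_Ioi,
      Set.inter_eq_self_of_subset_right hsub]
  refine ⟨fun s hs => ?_, ?_⟩
  · have := mellinConvergent_of_renewal hN0 hr hD hmono hx0 hg0 hren hs
    rwa [MellinConvergent, hfun, integrableOn_indicator_iff measurableSet_Ioi,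
      Set.inter_eq_self_of_subset_left hsub] at this
  · obtain ⟨E, hE, hEeq⟩ := exists_entire_mellin_of_renewal hN0 hr hD hmono hx0 hg0 hren
    have hnum : Differentiable ℂ fun s => s * E s := differentiable_id.mul hE
    have hden : Differentiable ℂ fun s : ℂ => 1 - ∑ j, (r j : ℂ) ^ s :=
      (differentiable_sum_cpow hr).const_sub 1
    refine ⟨fun s => s * E s / (1 - ∑ j, (r j : ℂ) ^ s), fun s _ => ?_, fun s hs => ?_,
      fun s hs => ?_⟩
    · exact (hnum.analyticAt s).meromorphicAt.div (hden.analyticAt s).meromorphicAt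
    · have hne : 1 - ∑ j, (r j : ℂ) ^ s ≠ 0 :=
        sub_ne_zero.2 (sum_cpow_ne_one_of_dimension_lt hN0 hr hD hs).symm
      simp only
      rw [← hmel, ← hEeq s hs]
      field_simp
    · exact (hnum.analyticAt s).div (hden.analyticAt s)
        (sub_ne_zero.2 fun h => hs h.symm)
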